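/- Suppose (u,p) solves Problem (P) with f = 0, with equal first-equation kernels k₁ = k₂ = k (|k(t,s)| ≤ C_k a.e. on the triangle) and with k₃ = k₄ ≡ 0, assume the inf-sup condition ‖B*q‖_{V'} ≥ β‖q‖_Q for all q ∈ H⊥ with β > 0, and assume g₀ = 0, i.e. ⟨g(t),q⟩ = 0 for all q ∈ H for a.e. t. Then for a.e. t ∈ J, ‖p̄(t)‖_Q ≤ (‖a‖/β²) ‖ḡ(t)‖_{Q'}, and consequently ‖p̄‖_{L¹(J;Q)} ≤ (‖a‖/β²) ‖ḡ‖_{L¹(J;Q')}. -/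

import Mathlib

open MeasureTheory

theorem gron_aux (T C : ℝ) (hC : 0 ≤ C) (φ : ℝ → ℝ) (hφ : Integrable φ) (h0 : ∀ t, 0 ≤ φ t)
    (h : ∀ᵐ t ∂volume, t ∈ Set.Icc (0:ℝ) T → φ t ≤ C * ∫ s in (0:ℝ)..t, φ s) :
    ∀ᵐ t ∂volume, t ∈ Set.Icc (0:ℝ) T → φ t ≤ 0 := by
  set Φ : ℝ → ℝ := fun t => ∫ s in (0:ℝ)..t, φ s with hΦ
  have hcont : Continuous Φ :=
    intervalIntegral.continuous_primitive (fun a b => hφ.intervalIntegrable) 0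
  set Ψ : ℝ → ℝ := fun t => ∫ s in (0:ℝ)..t, Φ s with hΨ
  have hder : ∀ t, HasDerivAt Ψ (Φ t) t := fun t =>
    intervalIntegral.integral_hasDerivAt_right (hcont.intervalIntegrable _ _)
      (hcont.stronglyMeasurableAtFilter _ _) hcont.continuousAt
  have hΦ0 : ∀ t, 0 ≤ t → 0 ≤ Φ t := fun t ht =>
    intervalIntegral.integral_nonneg ht (fun s _ => h0 s)
  have hΨ0 : ∀ t, 0 ≤ t → 0 ≤ Ψ t := fun t ht =>
    intervalIntegral.integral_nonneg ht (fun s hs => hΦ0 s hs.1)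
  have hle : ∀ t ∈ Set.Icc (0:ℝ) T, Φ t ≤ C * Ψ t := by
    intro t ht
    have : Φ t ≤ ∫ s in (0:ℝ)..t, C * Φ s := by
      apply intervalIntegral.integral_mono_ae_restrict ht.1 hφ.intervalIntegrable
        ((hcont.const_mul C).intervalIntegrable _ _)
      refine (ae_restrict_iff' measurableSet_Icc).2 ?_
      filter_upwards [h] with s hs hs'
      exact hs ⟨hs'.1, hs'.2.trans ht.2⟩
    rwa [intervalIntegral.integral_const_mul] at this
  have hz : ∀ t ∈ Set.Icc (0:ℝ) T, ‖Ψ t‖ ≤ gronwallBound 0 C 0 (t - 0) := by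
    apply norm_le_gronwallBound_of_norm_deriv_right_le (f' := Φ)
    · exact fun t _ => (hder t).continuousAt.continuousWithinAt
    · exact fun t _ => (hder t).hasDerivWithinAt
    · simp [hΨ]
    · intro t ht
      rw [Real.norm_of_nonneg (hΦ0 t ht.1), Real.norm_of_nonneg (hΨ0 t ht.1), add_zero]
      exact hle t ⟨ht.1, ht.2.le⟩
  filter_upwards [h] with t ht ht'
  have h1 := hz t ht'
  rw [gronwallBound_ε0, zero_mul] at h1
  have h2 : Ψ t = 0 := norm_le_zero_iff.1 h1
  have h3 := hle t ht'
  rw [h2, mul_zero] at h3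
  exact (ht ht').trans (mul_nonpos_of_nonneg_of_nonpos hC h3)

theorem cs_aux {V : Type*} [NormedAddCommGroup V] [InnerProductSpace ℝ V]
    (a : V →L[ℝ] V →L[ℝ] ℝ) (hs : ∀ v w : V, a v w = a w v) (hp : ∀ v : V, 0 ≤ a v v)
    (u : V) : ‖a u‖ ^ 2 ≤ ‖a‖ * a u u := by
  have hcs : ∀ v, (a u v) ^ 2 ≤ a u u * a v v := by
    intro v
    have := discrim_le_zero (a := a v v) (b := 2 * a u v) (c := a u u) (fun x => by
      have := hp (u + x • v)
      simp only [map_add, map_smul, add_apply, smul_apply,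
        smul_eq_mul] at this
      rw [hs v u] at this
      nlinarith)
    unfold discrim at this
    nlinarith
  have hn : 0 ≤ ‖a‖ * a u u := mul_nonneg a.opNorm_nonneg (hp u)
  have : ‖a u‖ ≤ Real.sqrt (‖a‖ * a u u) := by
    apply ContinuousLinearMap.opNorm_le_bound _ (Real.sqrt_nonneg _)
    intro v
    refine abs_le_of_sq_le_sq ?_ (by positivity)
    rw [mul_pow, Real.sq_sqrt hn]
    have h1 : a v v ≤ ‖a‖ * ‖v‖ * ‖v‖ := (le_abs_self _).trans (a.le_opNorm₂ v v)
    have := mul_le_mul_of_nonneg_left h1 (hp u)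
    nlinarith [hcs v]
  calc _ ≤ (Real.sqrt (‖a‖ * a u u)) ^ 2 := by gcongr
    _ = _ := Real.sq_sqrt hn

/-- Suppose `(u,p)` solves Problem (P) with `f = 0`, equal
first-equation kernels `k₁ = k₂ = k` and `k₃ = k₄ ≡ 0`, the inf-sup condition
`‖B*q‖ ≥ β‖q‖` holds for all `q ∈ H⊥`, and `g₀ = 0`. Then for a.e. `t ∈ J`,
`‖p̄(t)‖_Q ≤ (‖a‖/β²)‖ḡ(t)‖_{Q'}`, and consequently
`‖p̄‖_{L¹(J;Q)} ≤ (‖a‖/β²)‖ḡ‖_{L¹(J;Q')}`. -/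
theorem statement4
    {V Q : Type*} [NormedAddCommGroup V] [InnerProductSpace ℝ V] [CompleteSpace V]
    [NormedAddCommGroup Q] [InnerProductSpace ℝ Q] [CompleteSpace Q]
    (T : ℝ) (hT : 0 < T)
    (a : V →L[ℝ] V →L[ℝ] ℝ) (b : V →L[ℝ] Q →L[ℝ] ℝ) (c : Q →L[ℝ] Q →L[ℝ] ℝ)
    (ha_symm : ∀ v w : V, a v w = a w v) (ha_pos : ∀ v : V, 0 ≤ a v v)
    (hc_symm : ∀ q r : Q, c q r = c r q) (hc_pos : ∀ q : Q, 0 ≤ c q q)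
    (β : ℝ) (hβ : 0 < β)
    (hinfsupQ : ∀ q ∈ (LinearMap.ker (b.flip : Q →ₗ[ℝ] V →L[ℝ] ℝ))ᗮ, β * ‖q‖ ≤ ‖b.flip q‖)
    (k : ℝ → ℝ → ℝ) (Ck : ℝ) (hCk : 0 ≤ Ck)
    (hk_meas : Measurable (Function.uncurry k))
    (hk_bdd : ∀ᵐ ts : ℝ × ℝ ∂volume,
      0 ≤ ts.2 → ts.2 ≤ ts.1 → ts.1 ≤ T → |k ts.1 ts.2| ≤ Ck)
    (u : ℝ → V) (p : ℝ → Q) (g : ℝ → Q →L[ℝ] ℝ)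
    (hu : IntervalIntegrable u volume 0 T) (hp : IntervalIntegrable p volume 0 T)
    (hg : IntervalIntegrable g volume 0 T)
    (heq1 : ∀ᵐ t ∂volume, t ∈ Set.Icc (0:ℝ) T → ∀ v : V,
      a (u t) v + b v (p t)
        = ∫ s in (0:ℝ)..t, k t s * (a (u s) v + b v (p s)))
    (heq2 : ∀ᵐ t ∂volume, t ∈ Set.Icc (0:ℝ) T → ∀ q : Q,
      b (u t) q - c (p t) q = g t q)
    (hg₀ : ∀ᵐ t ∂volume, t ∈ Set.Icc (0:ℝ) T →
      ∀ q ∈ LinearMap.ker (b.flip : Q →ₗ[ℝ] V →L[ℝ] ℝ), g t q = 0)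
    (p₀ pbar : ℝ → Q)
    (hdec : ∀ t : ℝ, p₀ t ∈ LinearMap.ker (b.flip : Q →ₗ[ℝ] V →L[ℝ] ℝ) ∧
      pbar t ∈ (LinearMap.ker (b.flip : Q →ₗ[ℝ] V →L[ℝ] ℝ))ᗮ ∧ p t = p₀ t + pbar t)
    (gbar : ℝ → Q →L[ℝ] ℝ)
    (hgbar : ∀ t : ℝ, (∀ q ∈ (LinearMap.ker (b.flip : Q →ₗ[ℝ] V →L[ℝ] ℝ))ᗮ, gbar t q = g t q) ∧
      (∀ q ∈ LinearMap.ker (b.flip : Q →ₗ[ℝ] V →L[ℝ] ℝ), gbar t q = 0)) :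
    (∀ᵐ t ∂volume, t ∈ Set.Icc (0:ℝ) T →
      ‖pbar t‖ ≤ (‖a‖ / β ^ 2) * ‖gbar t‖) ∧
    (∫ t in (0:ℝ)..T, ‖pbar t‖) ≤ (‖a‖ / β ^ 2) * ∫ t in (0:ℝ)..T, ‖gbar t‖ := by
  have hw : IntervalIntegrable (fun t => a (u t) + b.flip (p t)) volume 0 T := by
    rw [intervalIntegrable_iff_integrableOn_Ioc_of_le hT.le] at hu hp ⊢
    exact (a.integrable_comp hu).add (b.flip.integrable_comp hp)
  set w : ℝ → V →L[ℝ] ℝ := fun t => a (u t) + b.flip (p t) with hwdef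
  rw [intervalIntegrable_iff_integrableOn_Icc_of_le hT.le] at hw
  have hφ := IntegrableOn.integrable_indicator (Integrable.norm hw) measurableSet_Icc
  set φ : ℝ → ℝ := (Set.Icc (0:ℝ) T).indicator (fun t => ‖w t‖) with hφdef
  have hφin : ∀ t ∈ Set.Icc (0:ℝ) T, φ t = ‖w t‖ := fun t ht => Set.indicator_of_mem ht _
  have hφ0 : ∀ t, 0 ≤ φ t := fun t => Set.indicator_nonneg (fun _ _ => norm_nonneg _) t
  have hk2 : ∀ᵐ t : ℝ, ∀ᵐ s : ℝ, 0 ≤ s → s ≤ t → t ≤ T → |k t s| ≤ Ck := by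
    rw [Measure.volume_eq_prod] at hk_bdd
    exact Measure.ae_ae_of_ae_prod hk_bdd
  have hgr : ∀ᵐ t ∂volume, t ∈ Set.Icc (0:ℝ) T → φ t ≤ Ck * ∫ s in (0:ℝ)..t, φ s := by
    filter_upwards [heq1, hk2] with t h1 h2 ht
    have hI0 : 0 ≤ ∫ s in (0:ℝ)..t, φ s :=
      intervalIntegral.integral_nonneg ht.1 (fun s _ => hφ0 s)
    rw [hφin t ht]
    apply ContinuousLinearMap.opNorm_le_bound _ (mul_nonneg hCk hI0)
    intro v
    have h3 : w t v = ∫ s in (0:ℝ)..t, k t s * (a (u s) v + b v (p s)) := h1 ht v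
    rw [h3, ← intervalIntegral.integral_const_mul, ← intervalIntegral.integral_mul_const]
    apply intervalIntegral.norm_integral_le_of_norm_le ht.1
    · filter_upwards [h2] with s hs hs'
      have hsT : s ∈ Set.Icc (0:ℝ) T := ⟨hs'.1.le, hs'.2.trans ht.2⟩
      rw [hφin s hsT, norm_mul, mul_assoc]
      exact mul_le_mul (hs hs'.1.le hs'.2 ht.2) ((w s).le_opNorm v) (norm_nonneg _) hCk
    · exact ((hφ.const_mul Ck).mul_const _).intervalIntegrable
  have hw0 := gron_aux T Ck hCk φ hφ hφ0 hgr
  have hproj : ∀ q : Q, ∃ x ∈ LinearMap.ker (b.flip : Q →ₗ[ℝ] V →L[ℝ] ℝ),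
      ∃ y ∈ (LinearMap.ker (b.flip : Q →ₗ[ℝ] V →L[ℝ] ℝ))ᗮ, q = x + y := by
    intro q
    have hcl : IsClosed ((LinearMap.ker (b.flip : Q →ₗ[ℝ] V →L[ℝ] ℝ)) : Set Q) :=
      ContinuousLinearMap.isClosed_ker b.flip
    have : CompleteSpace (LinearMap.ker (b.flip : Q →ₗ[ℝ] V →L[ℝ] ℝ)) :=
      hcl.completeSpace_coe
    obtain ⟨x, hx, y, hy, h⟩ := Submodule.exists_add_mem_mem_orthogonal (K :=
      LinearMap.ker (b.flip : Q →ₗ[ℝ] V →L[ℝ] ℝ)) q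
    exact ⟨x, hx, y, hy, h⟩
  have hgg : ∀ᵐ t ∂volume, t ∈ Set.Icc (0:ℝ) T → gbar t = g t := by
    filter_upwards [hg₀] with t h ht
    ext q
    obtain ⟨x, hx, y, hy, rfl⟩ := hproj q
    rw [map_add, map_add, (hgbar t).1 y hy, (hgbar t).2 x hx, h ht x hx]
  have main : ∀ᵐ t ∂volume, t ∈ Set.Icc (0:ℝ) T →
      ‖pbar t‖ ≤ (‖a‖ / β ^ 2) * ‖gbar t‖ := by
    filter_upwards [hw0, heq2, hgg, hg₀] with t h1 h2 h3 h4 ht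
    have h1 := h1 ht
    rw [hφin t ht] at h1
    have hwz : a (u t) + b.flip (p t) = 0 := norm_le_zero_iff.1 h1
    obtain ⟨hp0, hpb, hpt⟩ := hdec t
    have hb0 : b.flip (p₀ t) = 0 := hp0
    have hbp : b.flip (p t) = b.flip (pbar t) := by rw [hpt, map_add, hb0, zero_add]
    have hau : a (u t) = - b.flip (pbar t) := by
      rw [← hbp]; exact eq_neg_of_add_eq_zero_left hwz
    have hinf := hinfsupQ _ hpb
    rw [← norm_neg (b.flip (pbar t)), ← hau] at hinf
    have e1 : a (u t) (u t) + b (u t) (p t) = 0 := by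
      have := congrArg (fun F => F (u t)) hwz
      simpa using this
    have e2 := h2 ht (p t)
    have e3 : g t (p t) = gbar t (pbar t) := by
      rw [hpt, map_add, h4 ht _ hp0, zero_add, h3 ht]
    have e4 : a (u t) (u t) ≤ ‖gbar t‖ * ‖pbar t‖ := by
      have := neg_abs_le (gbar t (pbar t))
      have h5 : |gbar t (pbar t)| ≤ ‖gbar t‖ * ‖pbar t‖ := (gbar t).le_opNorm _
      linarith [hc_pos (p t)]
    have e5 := cs_aux a ha_symm ha_pos (u t)
    have e6 : (β * ‖pbar t‖) ^ 2 ≤ ‖a‖ * (‖gbar t‖ * ‖pbar t‖) :=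
      (pow_le_pow_left₀ (by positivity) hinf 2).trans
        (e5.trans (mul_le_mul_of_nonneg_left e4 a.opNorm_nonneg))
    rcases (norm_nonneg (pbar t)).eq_or_lt with h | h
    · rw [← h]; positivity
    · rw [div_mul_eq_mul_div, le_div_iff₀ (by positivity)]
      refine le_of_mul_le_mul_right ?_ h
      nlinarith
  refine ⟨main, ?_⟩
  rw [← intervalIntegral.integral_const_mul, intervalIntegral.integral_of_le hT.le,
    intervalIntegral.integral_of_le hT.le]
  rw [intervalIntegrable_iff_integrableOn_Ioc_of_le hT.le] at hg
  have hgb : IntegrableOn gbar (Set.Ioc 0 T) := by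
    refine hg.congr ?_
    refine (ae_restrict_iff' measurableSet_Ioc).2 ?_
    filter_upwards [hgg] with t h ht
    exact (h ⟨ht.1.le, ht.2⟩).symm
  apply integral_mono_of_nonneg
  · exact Filter.Eventually.of_forall fun _ => norm_nonneg _
  · exact hgb.norm.const_mul _
  · refine (ae_restrict_iff' measurableSet_Ioc).2 ?_
    filter_upwards [main] with t h ht
    exact h ⟨ht.1.le, ht.2⟩
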